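/- arXiv:2411.15776 — 9 statements merged into one kernel-verified Lean document; each statement's English description precedes it below -/
import Mathlib

section
/- Let f : ℝⁿ → ℝ be nonnegative and suppose the function z ↦ √(f(z)) is weakly convex with modulus τ > 0 on ℝⁿ. If x̃ ∈ ℝⁿ satisfies f(x̃) = 0, then f is Fréchet differentiable at x̃ with derivative 0, i.e. lim_{v→0} (f(x̃+v) − f(x̃))/‖v‖ = 0. -/
open Filter Topology RealInnerProductSpace

/-- Lemma 3.2(i): if `√f` is weakly convex with modulus `τ > 0` and
`f xt = 0`, then `f` is Fréchet differentiable at `xt` with derivative `0`, i.e.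
`(f (xt + v) - f xt) / ‖v‖ → 0` as `v → 0`. -/
theorem stmt_3 {n : ℕ} (f : EuclideanSpace ℝ (Fin n) → ℝ) (τ : ℝ) (hτ : 0 < τ)
    (hf : ∀ z, 0 ≤ f z)
    (hwc : ConvexOn ℝ Set.univ (fun z => Real.sqrt (f z) + τ / 2 * ‖z‖ ^ 2))
    (xt : EuclideanSpace ℝ (Fin n)) (hxt : f xt = 0) :
    Filter.Tendsto (fun v : EuclideanSpace ℝ (Fin n) => (f (xt + v) - f xt) / ‖v‖)
      (𝓝[≠] (0 : EuclideanSpace ℝ (Fin n))) (𝓝 0) := by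
  have h1 := hwc.locallyLipschitz
  have h2 : ConvexOn ℝ Set.univ (fun z : EuclideanSpace ℝ (Fin n) => τ / 2 * ‖z‖ ^ 2) := by
    have h := (convexOn_univ_norm (E := EuclideanSpace ℝ (Fin n))).pow
      (fun x _ => norm_nonneg x) 2
    exact h.smul (by positivity : 0 ≤ τ / 2)
  obtain ⟨K1, t1, ht1, hK1⟩ := h1 xt
  obtain ⟨K2, t2, ht2, hK2⟩ := h2.locallyLipschitz xt
  have hm : Tendsto (fun v : EuclideanSpace ℝ (Fin n) => xt + v) (𝓝[≠] 0) (𝓝 xt) := by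
    have h : Tendsto (fun v : EuclideanSpace ℝ (Fin n) => xt + v) (𝓝 0) (𝓝 (xt + 0)) :=
      (continuous_const.add continuous_id).tendsto 0
    rw [add_zero] at h
    exact h.mono_left nhdsWithin_le_nhds
  have hlim : Tendsto (fun v : EuclideanSpace ℝ (Fin n) => ((K1 : ℝ) + K2) ^ 2 * ‖v‖)
      (𝓝[≠] 0) (𝓝 0) := by
    have h : Tendsto (fun v : EuclideanSpace ℝ (Fin n) => ((K1 : ℝ) + K2) ^ 2 * ‖v‖)
      (𝓝 0) (𝓝 (((K1 : ℝ) + K2) ^ 2 * ‖(0 : EuclideanSpace ℝ (Fin n))‖)) :=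
      (continuous_const.mul continuous_norm).tendsto 0
    rw [norm_zero, mul_zero] at h
    exact h.mono_left nhdsWithin_le_nhds
  refine squeeze_zero' ?_ ?_ hlim
  · filter_upwards with v
    rw [hxt, sub_zero]
    exact div_nonneg (hf _) (norm_nonneg _)
  · filter_upwards [hm ht1, hm ht2, self_mem_nhdsWithin] with v hv1 hv2 hv0
    have hv : 0 < ‖v‖ := norm_pos_iff.mpr hv0
    have e1 := hK1.dist_le_mul _ hv1 _ (mem_of_mem_nhds ht1)
    have e2 := hK2.dist_le_mul _ hv2 _ (mem_of_mem_nhds ht2)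
    simp only [Real.dist_eq, dist_self_add_left, hxt, Real.sqrt_zero, zero_add] at e1 e2
    have a1 := (abs_le.mp e1).2
    have a2 := (abs_le.mp e2).1
    have hs : Real.sqrt (f (xt + v)) ≤ (K1 + K2) * ‖v‖ := by linarith
    have hq : f (xt + v) ≤ ((K1 + K2) * ‖v‖) ^ 2 := by
      rw [← Real.sq_sqrt (hf (xt + v))]
      exact pow_le_pow_left₀ (Real.sqrt_nonneg _) hs 2
    rw [hxt, sub_zero, div_le_iff₀ hv]
    linarith
end

section
/- Let f : ℝⁿ → ℝ be nonnegative, let φ(z) := √(f(z)), and suppose φ is weakly convex with modulus τ > 0 on ℝⁿ. Then for every x ∈ ℝⁿ, the Fréchet subdifferential of f at x satisfies ∂̂f(x) = {2√(f(x))·w : w ∈ ∂φ(x)}, where ∂φ(x) := {w ∈ ℝⁿ : ∀ z ∈ ℝⁿ, φ(z) ≥ φ(x) + ⟨w, z−x⟩ − (τ/2)‖z−x‖²}. -/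
open Filter Topology RealInnerProductSpace

/-- The Fréchet subdifferential of `ψ : ℝⁿ → ℝ` at `x`. -/
def frechetSubdiff {n : ℕ} (ψ : EuclideanSpace ℝ (Fin n) → ℝ)
    (x : EuclideanSpace ℝ (Fin n)) : Set (EuclideanSpace ℝ (Fin n)) :=
  {y | ∀ ε > (0 : ℝ), ∃ δ > (0 : ℝ), ∀ z, ‖z - x‖ < δ →
    ψ z ≥ ψ x + ⟪y, z - x⟫ - ε * ‖z - x‖}

/-- The subdifferential of a `τ`-weakly convex function `φ : ℝⁿ → ℝ` at `x`. -/
def weakSubdiff {n : ℕ} (φ : EuclideanSpace ℝ (Fin n) → ℝ) (τ : ℝ)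
    (x : EuclideanSpace ℝ (Fin n)) : Set (EuclideanSpace ℝ (Fin n)) :=
  {w | ∀ z, φ z ≥ φ x + ⟪w, z - x⟫ - τ / 2 * ‖z - x‖ ^ 2}

theorem key_aux {n : ℕ} (f : EuclideanSpace ℝ (Fin n) → ℝ) (τ : ℝ) (hτ : 0 < τ)
    (hf : ∀ z, 0 ≤ f z)
    (hwc : ConvexOn ℝ Set.univ (fun z => Real.sqrt (f z) + τ / 2 * ‖z‖ ^ 2))
    (x y h : EuclideanSpace ℝ (Fin n)) (hy : y ∈ frechetSubdiff f x) :
    ⟪y, h⟫ ≤ 2 * Real.sqrt (f x) *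
      (Real.sqrt (f (x + h)) - Real.sqrt (f x) + τ / 2 * ‖h‖ ^ 2) := by
  set s := Real.sqrt (f x) with hs
  set D := Real.sqrt (f (x + h)) - s + τ / 2 * ‖h‖ ^ 2 with hD
  have hh : 0 ≤ ‖h‖ := norm_nonneg h
  have main : ∀ ε > (0 : ℝ), ⟪y, h⟫ ≤ 2 * s * D + ε * (‖h‖ + 1) := by
    intro ε hε
    obtain ⟨δ, hδ, H⟩ := hy ε hε
    obtain ⟨t, ht0, ht1, ht2, ht3⟩ : ∃ t : ℝ, 0 < t ∧ t ≤ 1 ∧ t * (‖h‖ + 1) ≤ δ / 2 ∧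
        t * (D ^ 2 + 1) ≤ ε := by
      refine ⟨min 1 (min (δ / 2 / (‖h‖ + 1)) (ε / (D ^ 2 + 1))), by positivity,
        min_le_left _ _, ?_, ?_⟩
      · rw [← le_div_iff₀ (by positivity)]
        exact (min_le_right _ _).trans (min_le_left _ _)
      · rw [← le_div_iff₀ (by positivity)]
        exact (min_le_right _ _).trans (min_le_right _ _)
    have h1 := H (x + t • h) (by
      rw [add_sub_cancel_left, norm_smul, Real.norm_of_nonneg ht0.le]; nlinarith)
    rw [add_sub_cancel_left, norm_smul, Real.norm_of_nonneg ht0.le, inner_smul_right] at h1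
    have h2 := hwc.2 (Set.mem_univ x) (Set.mem_univ (x + h)) (sub_nonneg.2 ht1) ht0.le
      (by ring)
    have e : (1 - t) • x + t • (x + h) = x + t • h := by module
    rw [e] at h2
    simp only [smul_eq_mul] at h2
    rw [norm_add_sq_real, norm_add_sq_real, norm_smul, Real.norm_of_nonneg ht0.le,
      inner_smul_right, ← hs] at h2
    have h3 : Real.sqrt (f (x + t • h)) ≤ s + t * D := by
      have : 0 ≤ τ * (t ^ 2 * ‖h‖ ^ 2) := by positivity
      rw [hD]
      nlinarith
    have h4 : f (x + t • h) ≤ (s + t * D) ^ 2 := by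
      rw [← Real.sq_sqrt (hf (x + t • h))]
      exact pow_le_pow_left₀ (Real.sqrt_nonneg _) h3 2
    have h5 : f x = s ^ 2 := (Real.sq_sqrt (hf x)).symm
    have h6 : t * ⟪y, h⟫ ≤ t * (2 * s * D + t * D ^ 2 + ε * ‖h‖) := by
      rw [h5] at h1
      nlinarith
    have h7 := le_of_mul_le_mul_left h6 ht0
    nlinarith
  by_contra hc
  push Not at hc
  have := main ((⟪y, h⟫ - 2 * s * D) / (2 * (‖h‖ + 1)))
    (div_pos (by linarith) (by positivity))
  have e : (⟪y, h⟫ - 2 * s * D) / (2 * (‖h‖ + 1)) * (‖h‖ + 1)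
      = (⟪y, h⟫ - 2 * s * D) / 2 := by
    field_simp
  rw [e] at this
  linarith

/-- Lemma 3.2(ii)–(iii): `∂̂f(x) = 2√(f x) · ∂(√f)(x)`. -/
theorem stmt_4 {n : ℕ} (f : EuclideanSpace ℝ (Fin n) → ℝ) (τ : ℝ) (hτ : 0 < τ)
    (hf : ∀ z, 0 ≤ f z)
    (hwc : ConvexOn ℝ Set.univ (fun z => Real.sqrt (f z) + τ / 2 * ‖z‖ ^ 2)) :
    ∀ x : EuclideanSpace ℝ (Fin n),
      frechetSubdiff f x
        = (fun w => (2 * Real.sqrt (f x)) • w) ''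
            weakSubdiff (fun z => Real.sqrt (f z)) τ x := by
  intro x
  ext y
  constructor
  · intro hy
    have K := fun h => key_aux f τ hτ hf hwc x y h hy
    rcases (Real.sqrt_nonneg (f x)).eq_or_lt with h0 | hpos
    · refine ⟨0, ?_, ?_⟩
      · intro z
        simp only [inner_zero_left, ← h0]
        have := Real.sqrt_nonneg (f z)
        have : 0 ≤ τ / 2 * ‖z - x‖ ^ 2 := by positivity
        linarith
      · have := K y
        rw [← h0] at this
        simp only [mul_zero, zero_mul] at this
        simp only [smul_zero]
        rw [real_inner_self_eq_norm_sq] at this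
        have h3 : ‖y‖ = 0 := by nlinarith [norm_nonneg y]
        exact (norm_eq_zero.1 h3).symm
    · refine ⟨(2 * Real.sqrt (f x))⁻¹ • y, ?_, ?_⟩
      · intro z
        have := K (z - x)
        rw [add_sub_cancel] at this
        rw [real_inner_smul_left]
        have h2 : (2 * Real.sqrt (f x))⁻¹ * ⟪y, z - x⟫ ≤
            Real.sqrt (f z) - Real.sqrt (f x) + τ / 2 * ‖z - x‖ ^ 2 := by
          rw [inv_mul_le_iff₀ (by positivity)]
          exact this
        simp only
        linarith
      · exact smul_inv_smul₀ (by positivity) y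
  · rintro ⟨w, hw, rfl⟩ ε hε
    have hs := Real.sqrt_nonneg (f x)
    refine ⟨ε / (Real.sqrt (f x) * τ + 1), by positivity, fun z hz => ?_⟩
    rw [lt_div_iff₀ (by positivity)] at hz
    have hw' := hw z
    simp only at hw' ⊢
    rw [real_inner_smul_left]
    have hx2 := Real.sq_sqrt (hf x)
    have hz2 := Real.sq_sqrt (hf z)
    have hn := norm_nonneg (z - x)
    have h1 := mul_le_mul_of_nonneg_left hw' hs
    have h2 := mul_le_mul_of_nonneg_right hz.le hn
    nlinarith [sq_nonneg (Real.sqrt (f z) - Real.sqrt (f x)), sq_nonneg ‖z - x‖]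
end

section
/- Let f : ℝⁿ → ℝ be nonnegative with z ↦ √(f(z)) weakly convex with modulus τ > 0 on ℝⁿ. Then for every x, v ∈ ℝⁿ, the one-sided directional derivative f'(x;v) exists and equals the Clarke generalized directional derivative f°(x;v), i.e. f is C(larke)-regular. -/
open Filter Topology RealInnerProductSpace

/-- Lemma 3.2(iii): if `f ≥ 0` and `√f` is weakly convex with modulus
`τ > 0`, then `f` is Clarke-regular: for all `x, v` the one-sided directional derivative
`f'(x;v)` exists and equals the Clarke generalized directional derivative `f°(x;v)`. -/
theorem stmt_5 {n : ℕ} (f : EuclideanSpace ℝ (Fin n) → ℝ) (τ : ℝ) (hτ : 0 < τ)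
    (hf : ∀ z, 0 ≤ f z)
    (hwc : ConvexOn ℝ Set.univ (fun z => Real.sqrt (f z) + τ / 2 * ‖z‖ ^ 2)) :
    ∀ x v : EuclideanSpace ℝ (Fin n), ∃ d : ℝ,
      Filter.Tendsto (fun t : ℝ => (f (x + t • v) - f x) / t) (𝓝[>] (0 : ℝ)) (𝓝 d) ∧
      Filter.limsup
          (fun p : EuclideanSpace ℝ (Fin n) × ℝ => (f (p.1 + p.2 • v) - f p.1) / p.2)
          ((𝓝 x) ×ˢ (𝓝[>] (0 : ℝ))) = d := by
  intro x v
  obtain ⟨g, hg⟩ : ∃ g : EuclideanSpace ℝ (Fin n) → ℝ,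
      g = fun z => Real.sqrt (f z) + τ / 2 * ‖z‖ ^ 2 := ⟨_, rfl⟩
  rw [← hg] at hwc
  have hgc : Continuous g := hwc.locallyLipschitz.continuous
  have hs : ∀ z, Real.sqrt (f z) = g z - τ / 2 * ‖z‖ ^ 2 := fun z => by rw [hg]; ring
  have hsc : Continuous (fun z => Real.sqrt (f z)) := by
    simp only [hs]; fun_prop
  -- restriction to lines
  have hline : ∀ y, ConvexOn ℝ Set.univ (fun t : ℝ => g (y + t • v)) := by
    intro y
    refine ⟨convex_univ, fun a _ b _ p q hp hq hpq => ?_⟩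
    have h := hwc.2 (Set.mem_univ (y + a • v)) (Set.mem_univ (y + b • v)) hp hq hpq
    have e : p • (y + a • v) + q • (y + b • v) = y + (p • a + q • b) • v := by
      have : y = (p + q) • y := by rw [hpq, one_smul]
      conv_rhs => rw [this]
      simp only [smul_eq_mul]
      module
    rw [e] at h
    exact h
  have hmono : ∀ y (s t : ℝ), 0 < s → s ≤ t →
      (g (y + s • v) - g y) / s ≤ (g (y + t • v) - g y) / t := by
    intro y s t hs0 hst
    have h := (hline y).secant_mono (a := 0) (Set.mem_univ _) (Set.mem_univ s) (Set.mem_univ t)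
      hs0.ne' (hs0.trans_le hst).ne' hst
    simpa using h
  obtain ⟨dg, hdg⟩ : ∃ dg, Tendsto (fun t : ℝ => (g (x + t • v) - g x) / t) (𝓝[>] (0 : ℝ)) (𝓝 dg) := by
    have h := (hline x).hasDerivWithinAt_rightDeriv_of_mem_interior (x := 0) (by simp)
    rw [hasDerivWithinAt_iff_tendsto_slope' (by simp)] at h
    refine ⟨_, h.congr fun t => ?_⟩
    simp [slope_def_field]
  set A : EuclideanSpace ℝ (Fin n) × ℝ → ℝ :=
    fun p => Real.sqrt (f (p.1 + p.2 • v)) + Real.sqrt (f p.1) with hA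
  set R : EuclideanSpace ℝ (Fin n) × ℝ → ℝ :=
    fun p => τ / 2 * (2 * inner ℝ p.1 v + p.2 * ‖v‖ ^ 2) with hR
  have hAc : Continuous A := by
    have h1 : Continuous (fun p : EuclideanSpace ℝ (Fin n) × ℝ => Real.sqrt (f (p.1 + p.2 • v))) :=
      hsc.comp (by fun_prop : Continuous fun p : EuclideanSpace ℝ (Fin n) × ℝ => p.1 + p.2 • v)
    exact h1.add (hsc.comp continuous_fst)
  have hRc : Continuous R := by rw [hR]; fun_prop
  have hA0 : ∀ p, 0 ≤ A p := fun p => add_nonneg (Real.sqrt_nonneg _) (Real.sqrt_nonneg _)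
  have key : ∀ (y : EuclideanSpace ℝ (Fin n)) (t : ℝ), 0 < t → (f (y + t • v) - f y) / t =
      A (y, t) * ((g (y + t • v) - g y) / t - R (y, t)) := by
    intro y t ht
    have h1 : R (y, t) = (τ / 2 * ‖y + t • v‖ ^ 2 - τ / 2 * ‖y‖ ^ 2) / t := by
      rw [norm_add_sq_real, inner_smul_right, norm_smul, hR, Real.norm_eq_abs, mul_pow, sq_abs]
      field_simp
      ring
    rw [h1, ← sub_div, mul_div_assoc']
    congr 1
    have e1 := hs (y + t • v)
    have e2 := hs y
    have e3 : g (y + t • v) - g y - (τ / 2 * ‖y + t • v‖ ^ 2 - τ / 2 * ‖y‖ ^ 2)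
      = Real.sqrt (f (y + t • v)) - Real.sqrt (f y) := by rw [e1, e2]; ring
    rw [e3]
    have e4 := Real.sq_sqrt (hf (y + t • v))
    have e5 := Real.sq_sqrt (hf y)
    simp only [hA]
    nlinarith
  set L := (𝓝 x) ×ˢ (𝓝[>] (0 : ℝ)) with hL
  have hLle : L ≤ 𝓝 (x, (0:ℝ)) := by
    rw [nhds_prod_eq]; exact prod_mono le_rfl nhdsWithin_le_nhds
  have hι : Tendsto (fun t : ℝ => (x, t)) (𝓝[>] (0 : ℝ)) L :=
    tendsto_const_nhds.prodMk tendsto_id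
  have hpos : ∀ᶠ p in L, 0 < p.2 := tendsto_snd.eventually self_mem_nhdsWithin
  have hAL : Tendsto A L (𝓝 (A (x, 0))) := (hAc.tendsto _).mono_left hLle
  have hRL : Tendsto R L (𝓝 (R (x, 0))) := (hRc.tendsto _).mono_left hLle
  have hlim : Tendsto (fun t : ℝ => (f (x + t • v) - f x) / t) (𝓝[>] (0 : ℝ))
      (𝓝 (A (x, 0) * (dg - R (x, 0)))) := by
    refine ((hAL.comp hι).mul (hdg.sub (hRL.comp hι))).congr' ?_
    filter_upwards [self_mem_nhdsWithin] with t ht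
    exact (key x t ht).symm
  have hup : ∀ c > A (x, 0) * (dg - R (x, 0)), ∀ᶠ p in L,
      (f (p.1 + p.2 • v) - f p.1) / p.2 < c := by
    intro c hc
    -- choose a slack
    obtain ⟨ε, hε, hεc⟩ : ∃ ε > 0, A (x, 0) * (dg + ε - R (x, 0)) < c := by
      have hcont : Tendsto (fun ε : ℝ => A (x, 0) * (dg + ε - R (x, 0))) (𝓝[>] 0)
          (𝓝 (A (x, 0) * (dg + 0 - R (x, 0)))) :=
        ((by fun_prop : Continuous fun ε : ℝ => A (x, 0) * (dg + ε - R (x, 0))).tendsto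
          0).mono_left nhdsWithin_le_nhds
      rw [add_zero] at hcont
      obtain ⟨ε, h1, h2⟩ := ((hcont.eventually_lt_const hc).and self_mem_nhdsWithin).exists
      exact ⟨ε, h2, h1⟩
    obtain ⟨t₀, h1, h2⟩ := ((hdg.eventually_lt_const (lt_add_of_pos_right dg hε)).and
      self_mem_nhdsWithin).exists
    have ht₀ : 0 < t₀ := h2
    have hc1 : Continuous fun y => (g (y + t₀ • v) - g y) / t₀ := by
      have : Continuous fun y => g (y + t₀ • v) := hgc.comp (by fun_prop)
      exact (this.sub hgc).div_const _
    have hy : ∀ᶠ p in L, (g (p.1 + t₀ • v) - g p.1) / t₀ < dg + ε :=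
      tendsto_fst.eventually ((hc1.tendsto x).eventually_lt_const h1)
    have ht : ∀ᶠ p in L, p.2 < t₀ :=
      tendsto_snd.eventually (nhdsWithin_le_nhds (Iio_mem_nhds ht₀))
    have hB : ∀ᶠ p in L, A p * (dg + ε - R p) < c :=
      (hAL.mul (hRL.const_sub (dg + ε))).eventually_lt_const hεc
    filter_upwards [hy, ht, hB, hpos] with p hp1 hp2 hp3 hp4
    rw [key p.1 p.2 hp4]
    refine lt_of_le_of_lt (mul_le_mul_of_nonneg_left ?_ (hA0 p)) hp3
    have := hmono p.1 p.2 t₀ hp4 hp2.le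
    show _ - R p ≤ _
    linarith
  have hlow : ∀ c < A (x, 0) * (dg - R (x, 0)), ∃ᶠ p in L,
      c < (f (p.1 + p.2 • v) - f p.1) / p.2 := by
    intro c hc
    exact hι.frequently (hlim.eventually_const_lt hc).frequently
  refine ⟨_, hlim, ?_⟩
  have hbd : L.IsBoundedUnder (· ≤ ·)
      (fun p : EuclideanSpace ℝ (Fin n) × ℝ => (f (p.1 + p.2 • v) - f p.1) / p.2) :=
    ⟨_, eventually_map.2 ((hup _ (lt_add_one _)).mono fun p hp => hp.le)⟩
  have hcobd : L.IsCoboundedUnder (· ≤ ·)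
      (fun p : EuclideanSpace ℝ (Fin n) × ℝ => (f (p.1 + p.2 • v) - f p.1) / p.2) :=
    IsCoboundedUnder.of_frequently_ge ((hlow _ (sub_one_lt _)).mono fun p hp => hp.le)
  refine le_antisymm ((limsup_le_iff hcobd hbd).2 hup) ((le_limsup_iff hcobd hbd).2 hlow)
end

section
/- Let h1, h2 : ℝⁿ → ℝ be convex, let r, g : ℝⁿ → ℝ be continuously differentiable, let f : ℝⁿ → ℝ be nonnegative with φ(z) := √(f(z)) weakly convex with modulus τ > 0 on ℝⁿ, and let x̄ ∈ ℝⁿ with g(x̄) > 0. Let T be a linear subspace of ℝⁿ and Tᗮ its orthogonal complement (T plays the role of the tangent space of the constraint manifold at x̄ and Tᗮ the normal space). Set F := h1 − h2 − f/g + r and ∂f(x̄) := {2√(f(x̄))·w : w ∈ ∂φ(x̄)}. Then the following are equivalent: (a) for every v ∈ T the one-sided directional derivative F'(x̄;v) exists and F'(x̄;v) ≥ 0; (b) ∂h2(x̄) + (1/g(x̄))·∂f(x̄) ⊆ ∂h1(x̄) + ∇r(x̄) + (f(x̄)/g(x̄)²)·∇g(x̄) + Tᗮ. -/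
open Filter Topology RealInnerProductSpace Pointwise

/-- `φ` has one-sided directional derivative `d` at `x` along `v`. -/
def HasDirDeriv {n : ℕ} (φ : EuclideanSpace ℝ (Fin n) → ℝ)
    (x v : EuclideanSpace ℝ (Fin n)) (d : ℝ) : Prop :=
  Filter.Tendsto (fun t : ℝ => (φ (x + t • v) - φ x) / t) (𝓝[>] (0 : ℝ)) (𝓝 d)

/-- The subdifferential of a convex function `ψ : ℝⁿ → ℝ` at `x`. -/
def convexSubdiff {n : ℕ} (ψ : EuclideanSpace ℝ (Fin n) → ℝ)
    (x : EuclideanSpace ℝ (Fin n)) : Set (EuclideanSpace ℝ (Fin n)) :=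
  {y | ∀ z, ψ z ≥ ψ x + ⟪y, z - x⟫}

theorem hasDirDeriv_iff {n : ℕ} (φ : EuclideanSpace ℝ (Fin n) → ℝ)
    (x v : EuclideanSpace ℝ (Fin n)) (d : ℝ) :
    HasDirDeriv φ x v d ↔
      HasDerivWithinAt (fun t : ℝ => φ (x + t • v)) d (Set.Ioi 0) 0 := by
  rw [hasDerivWithinAt_iff_tendsto_slope' (by simp)]
  unfold HasDirDeriv
  refine Filter.tendsto_congr (fun t => ?_)
  simp [slope_def_field]

theorem convexDir {n : ℕ} (ψ : EuclideanSpace ℝ (Fin n) → ℝ) (hψ : ConvexOn ℝ Set.univ ψ)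
    (x : EuclideanSpace ℝ (Fin n)) :
    ∃ p : EuclideanSpace ℝ (Fin n) → ℝ, (∀ v, HasDirDeriv ψ x v (p v)) ∧
      (∀ c : ℝ, 0 < c → ∀ v, p (c • v) = c * p v) ∧ (∀ u v, p (u + v) ≤ p u + p v) ∧
      (∀ y, y ∈ convexSubdiff ψ x ↔ ∀ v, ⟪y, v⟫ ≤ p v) := by
  have hex : ∀ v, ∃ d, HasDirDeriv ψ x v d := by
    intro v
    have hc : ConvexOn ℝ Set.univ (fun t : ℝ => ψ (x + t • v)) := by
      refine ⟨convex_univ, fun a _ b _ s t hs ht hst => ?_⟩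
      have := hψ.2 (Set.mem_univ (x + a • v)) (Set.mem_univ (x + b • v)) hs ht hst
      convert this using 2
      have : t = 1 - s := by linarith
      subst this
      simp only [smul_eq_mul]
      module
    have := hc.differentiableWithinAt_Ioi_of_mem_interior (x := 0) (by simp)
    exact ⟨_, (hasDirDeriv_iff _ _ _ _).2 this.hasDerivWithinAt⟩
  choose p hp using hex
  have hhom : ∀ c : ℝ, 0 < c → ∀ v, p (c • v) = c * p v := by
    intro c hc v
    have h1 := hp (c • v)
    have h2 : Tendsto (fun t : ℝ => c * t) (𝓝[>] 0) (𝓝[>] 0) := by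
      refine tendsto_nhdsWithin_iff.2 ⟨?_, ?_⟩
      · have : Tendsto (fun t : ℝ => c * t) (𝓝 0) (𝓝 (c * 0)) := by
          exact (continuous_const.mul continuous_id).tendsto 0
        rw [mul_zero] at this
        exact this.mono_left nhdsWithin_le_nhds
      · filter_upwards [self_mem_nhdsWithin] with t ht
        exact mul_pos hc ht
    have h3 := ((hp v).comp h2).const_mul c
    refine tendsto_nhds_unique h1 (h3.congr' ?_)
    filter_upwards [self_mem_nhdsWithin] with t ht
    have ht : 0 < t := ht
    simp only [Function.comp, smul_smul]
    rw [mul_comm t c]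
    field_simp
  refine ⟨p, hp, hhom, ?_, ?_⟩
  · intro u v
    have h2 : ∀ w, p ((2 : ℝ) • w) = 2 * p w := hhom 2 (by norm_num)
    have key : p (u + v) ≤ (1/2) * p ((2 : ℝ) • u) + (1/2) * p ((2 : ℝ) • v) := by
      refine le_of_tendsto_of_tendsto (hp (u + v))
        (((hp ((2 : ℝ) • u)).const_mul (1/2)).add ((hp ((2 : ℝ) • v)).const_mul (1/2))) ?_
      filter_upwards [self_mem_nhdsWithin] with t ht
      have ht : 0 < t := ht
      have := hψ.2 (Set.mem_univ (x + t • (2 : ℝ) • u)) (Set.mem_univ (x + t • (2 : ℝ) • v))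
        (show (0 : ℝ) ≤ 1/2 by norm_num) (show (0 : ℝ) ≤ 1/2 by norm_num) (by norm_num)
      have e : (1/2 : ℝ) • (x + t • (2 : ℝ) • u) + (1/2 : ℝ) • (x + t • (2 : ℝ) • v)
          = x + t • (u + v) := by module
      rw [e] at this
      simp only [smul_eq_mul] at this
      rw [← mul_add, ← add_div, ← mul_div_assoc]
      apply div_le_div_of_nonneg_right _ ht.le
      linarith
    rw [h2, h2] at key
    linarith
  · intro y
    constructor
    · intro hy v
      refine ge_of_tendsto (hp v) ?_
      filter_upwards [self_mem_nhdsWithin] with t ht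
      have ht : 0 < t := ht
      have := hy (x + t • v)
      rw [add_sub_cancel_left, inner_smul_right] at this
      rw [le_div_iff₀ ht]
      linarith
    · intro hy z
      have h1 : p (z - x) ≤ ψ z - ψ x := by
        refine le_of_tendsto (hp (z - x)) ?_
        filter_upwards [Ioo_mem_nhdsGT (show (0 : ℝ) < 1 by norm_num)] with t ht
        have := hψ.2 (Set.mem_univ x) (Set.mem_univ z)
          (show (0 : ℝ) ≤ 1 - t by linarith [ht.2]) ht.1.le (by ring)
        have e : (1 - t) • x + t • z = x + t • (z - x) := by module
        rw [e] at this
        simp only [smul_eq_mul] at this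
        rw [div_le_iff₀ ht.1]
        linarith
      linarith [hy (z - x)]

theorem hbExt {n : ℕ} (p : EuclideanSpace ℝ (Fin n) → ℝ)
    (hhom : ∀ c : ℝ, 0 < c → ∀ v, p (c • v) = c * p v) (hadd : ∀ u v, p (u + v) ≤ p u + p v)
    (T : Submodule ℝ (EuclideanSpace ℝ (Fin n))) (z : EuclideanSpace ℝ (Fin n))
    (hz : ∀ v ∈ T, ⟪z, v⟫ ≤ p v) :
    ∃ u, (∀ v, ⟪u, v⟫ ≤ p v) ∧ ∀ v ∈ T, ⟪u, v⟫ = ⟪z, v⟫ := by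
  obtain ⟨L, hL, hLp⟩ := exists_extension_of_le_sublinear
    ⟨T, (innerSL ℝ z).toLinearMap.comp T.subtype⟩ p hhom hadd
    (by rintro ⟨v, hv⟩; exact hz v hv)
  refine ⟨(InnerProductSpace.toDual ℝ _).symm L.toContinuousLinearMap, fun v => ?_, fun v hv => ?_⟩
  · rw [InnerProductSpace.toDual_symm_apply]
    exact hLp v
  · rw [InnerProductSpace.toDual_symm_apply]
    exact hL ⟨v, hv⟩

theorem hbMax {n : ℕ} (p : EuclideanSpace ℝ (Fin n) → ℝ)
    (hhom : ∀ c : ℝ, 0 < c → ∀ v, p (c • v) = c * p v) (hadd : ∀ u v, p (u + v) ≤ p u + p v)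
    (v : EuclideanSpace ℝ (Fin n)) :
    ∃ u, (∀ w, ⟪u, w⟫ ≤ p w) ∧ ⟪u, v⟫ = p v := by
  have h0 : p 0 = 0 := by
    have := hhom 2 (by norm_num) 0
    rw [smul_zero] at this
    linarith
  have hv : ⟪(p v / ‖v‖ ^ 2) • v, v⟫ = p v := by
    rw [real_inner_smul_left, real_inner_self_eq_norm_sq]
    rcases eq_or_ne v 0 with rfl | h
    · simp [h0]
    · have : ‖v‖ ≠ 0 := norm_ne_zero_iff.2 h
      field_simp
  obtain ⟨u, hu, hu2⟩ := hbExt p hhom hadd (Submodule.span ℝ {v}) ((p v / ‖v‖ ^ 2) • v) (by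
    intro w hw
    obtain ⟨c, rfl⟩ := Submodule.mem_span_singleton.1 hw
    rw [inner_smul_right, hv]
    rcases lt_trichotomy c 0 with hc | rfl | hc
    · have h1 := hhom (-c) (by linarith) v
      have h2 := hadd ((-c) • v) (c • v)
      rw [← add_smul] at h2
      simp only [neg_add_cancel, zero_smul, h0] at h2
      linarith
    · simp [h0]
    · rw [hhom c hc])
  exact ⟨u, hu, (hu2 v (Submodule.mem_span_singleton_self v)).trans hv⟩

theorem weak_iff {n : ℕ} (φ : EuclideanSpace ℝ (Fin n) → ℝ) (τ : ℝ)
    (x w : EuclideanSpace ℝ (Fin n)) :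
    w ∈ weakSubdiff φ τ x ↔
      w + τ • x ∈ convexSubdiff (fun z => φ z + τ / 2 * ‖z‖ ^ 2) x := by
  refine forall_congr' fun z => ?_
  have e : ‖z - x‖ ^ 2 = ‖z‖ ^ 2 - 2 * ⟪x, z⟫ + ‖x‖ ^ 2 := by
    rw [norm_sub_sq_real, real_inner_comm]
  have e2 : ⟪w + τ • x, z - x⟫ = ⟪w, z - x⟫ + τ * (⟪x, z⟫ - ‖x‖ ^ 2) := by
    rw [inner_add_left, real_inner_smul_left, inner_sub_right x, real_inner_self_eq_norm_sq]
  rw [e2, e]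
  constructor <;> intro h <;> linarith

theorem lineDeriv_of_contDiff {n : ℕ} (r : EuclideanSpace ℝ (Fin n) → ℝ) (hr : ContDiff ℝ 1 r)
    (x v : EuclideanSpace ℝ (Fin n)) :
    HasDerivWithinAt (fun t : ℝ => r (x + t • v)) ⟪gradient r x, v⟫ (Set.Ioi 0) 0 := by
  have h1 : HasFDerivAt r (fderiv ℝ r x) (x + (0 : ℝ) • v) := by
    rw [zero_smul, add_zero]
    exact (hr.differentiable (by norm_num) x).hasFDerivAt
  have h2 : HasDerivAt (fun t : ℝ => x + t • v) v 0 := by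
    simpa using ((hasDerivAt_id (0 : ℝ)).smul_const v).const_add x
  have h3 := h1.comp_hasDerivAt (0 : ℝ) h2
  have e : ⟪gradient r x, v⟫ = fderiv ℝ r x v := by
    unfold gradient
    rw [InnerProductSpace.toDual_symm_apply]
  rw [e]
  exact h3.hasDerivWithinAt

/-- Proposition 3.3: B-stationarity of `F = h1 - h2 - f/g + r` at `xb`
relative to the tangent space `T` is equivalent to the subdifferential inclusion
`∂h2(xb) + (1/g(xb))·∂f(xb) ⊆ ∂h1(xb) + ∇r(xb) + (f(xb)/g(xb)²)·∇g(xb) + Tᗮ`,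
where `∂f(xb) = 2√(f xb) · ∂(√f)(xb)`. -/
theorem stmt_6 {n : ℕ} (h1 h2 r g f : EuclideanSpace ℝ (Fin n) → ℝ)
    (hh1 : ConvexOn ℝ Set.univ h1) (hh2 : ConvexOn ℝ Set.univ h2)
    (hr : ContDiff ℝ 1 r) (hg : ContDiff ℝ 1 g)
    (hf : ∀ z, 0 ≤ f z) (τ : ℝ) (hτ : 0 < τ)
    (hwc : ConvexOn ℝ Set.univ (fun z => Real.sqrt (f z) + τ / 2 * ‖z‖ ^ 2))
    (xb : EuclideanSpace ℝ (Fin n)) (hgx : 0 < g xb)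
    (T : Submodule ℝ (EuclideanSpace ℝ (Fin n))) :
    (∀ v ∈ T, ∃ d : ℝ,
        HasDirDeriv (fun z => h1 z - h2 z - f z / g z + r z) xb v d ∧ 0 ≤ d)
      ↔ convexSubdiff h2 xb
            + (g xb)⁻¹ • ((fun w => (2 * Real.sqrt (f xb)) • w) ''
                weakSubdiff (fun z => Real.sqrt (f z)) τ xb)
          ⊆ convexSubdiff h1 xb + {gradient r xb}
              + {(f xb / (g xb) ^ 2) • gradient g xb} + (Tᗮ : Set (EuclideanSpace ℝ (Fin n))) := by
  obtain ⟨p1, hp1, hom1, add1, sub1⟩ := convexDir h1 hh1 xb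
  obtain ⟨p2, hp2, hom2, add2, sub2⟩ := convexDir h2 hh2 xb
  obtain ⟨P, hP, homP, addP, subP⟩ := convexDir _ hwc xb
  set s := Real.sqrt (f xb) with hs
  set c := gradient r xb + (f xb / (g xb) ^ 2) • gradient g xb with hc
  have hD : ∀ v, HasDirDeriv (fun z => h1 z - h2 z - f z / g z + r z) xb v
      (p1 v - p2 v - (g xb)⁻¹ * (2 * s) * (P v - τ * ⟪xb, v⟫) + ⟪c, v⟫) := by
    intro v
    rw [hasDirDeriv_iff]
    have d1 := (hasDirDeriv_iff _ _ _ _).1 (hp1 v)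
    have d2 := (hasDirDeriv_iff _ _ _ _).1 (hp2 v)
    have dP := (hasDirDeriv_iff _ _ _ _).1 (hP v)
    have dr := lineDeriv_of_contDiff r hr xb v
    have dg := lineDeriv_of_contDiff g hg xb v
    have dn : HasDerivWithinAt (fun t : ℝ => τ / 2 * ‖xb + t • v‖ ^ 2) (τ * ⟪xb, v⟫)
        (Set.Ioi 0) 0 := by
      have h2 : HasDerivAt (fun t : ℝ => xb + t • v) v 0 := by
        simpa using ((hasDerivAt_id (0 : ℝ)).smul_const v).const_add xb
      have h3 := (h2.norm_sq.const_mul (τ / 2)).hasDerivWithinAt (s := Set.Ioi 0)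
      refine h3.congr_deriv ?_
      simp only [zero_smul, add_zero]
      ring
    have ds : HasDerivWithinAt (fun t : ℝ => Real.sqrt (f (xb + t • v)))
        (P v - τ * ⟪xb, v⟫) (Set.Ioi 0) 0 := by
      refine (dP.sub dn).congr_of_eventuallyEq ?_ ?_
      · exact Filter.Eventually.of_forall fun t => by simp
      · simp
    have df : HasDerivWithinAt (fun t : ℝ => f (xb + t • v))
        (2 * s * (P v - τ * ⟪xb, v⟫)) (Set.Ioi 0) 0 := by
      have := ds.pow 2
      refine (this.congr_deriv ?_).congr_of_eventuallyEq ?_ ?_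
      · simp [hs]
      · exact Filter.Eventually.of_forall fun t => by simp [Real.sq_sqrt (hf _)]
      · simp [Real.sq_sqrt (hf _)]
    have dq := df.div dg (by simpa using hgx.ne')
    have dF := ((d1.sub d2).sub dq).add dr
    refine dF.congr_deriv ?_
    simp only [zero_smul, add_zero, hc, inner_add_left, real_inner_smul_left]
    field_simp
    ring
  have hs0 : 0 ≤ (g xb)⁻¹ * (2 * s) := by positivity
  constructor
  · intro ha
    rintro _ ⟨y, hy, _, ⟨_, ⟨w, hw, rfl⟩, rfl⟩, rfl⟩
    rw [weak_iff, subP] at hw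
    rw [sub2] at hy
    have hz : ∀ v ∈ T, ⟪y + ((g xb)⁻¹ * (2 * s)) • w - c, v⟫ ≤ p1 v := by
      intro v hv
      obtain ⟨d, hd, hd0⟩ := ha v hv
      have hdd := tendsto_nhds_unique hd (hD v)
      have a1 := hy v
      have a2 := hw v
      rw [inner_add_left, real_inner_smul_left] at a2
      have a3 := mul_le_mul_of_nonneg_left (show ⟪w, v⟫ ≤ P v - τ * ⟪xb, v⟫ by linarith) hs0
      rw [inner_sub_left, inner_add_left, real_inner_smul_left]
      linarith
    obtain ⟨u, hu, hu2⟩ := hbExt p1 hom1 add1 T _ hz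
    refine ⟨u + gradient r xb + (f xb / (g xb) ^ 2) • gradient g xb,
      ⟨u + gradient r xb, ⟨u, (sub1 u).2 hu, _, rfl, rfl⟩, _, rfl, rfl⟩,
      y + ((g xb)⁻¹ * (2 * s)) • w - c - u, ?_, ?_⟩
    · refine (Submodule.mem_orthogonal' _ _).2 fun v hv => ?_
      rw [inner_sub_left, hu2 v hv, sub_self]
    · simp only [hc, smul_smul]
      abel
  · intro hb v hv
    refine ⟨_, hD v, ?_⟩
    obtain ⟨y, hy, hyv⟩ := hbMax p2 hom2 add2 v
    obtain ⟨W, hW, hWv⟩ := hbMax P homP addP v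
    have hw : W - τ • xb ∈ weakSubdiff (fun z => Real.sqrt (f z)) τ xb := by
      rw [weak_iff, subP, sub_add_cancel]
      exact hW
    obtain ⟨_, ⟨_, ⟨u, hu, _, rfl, rfl⟩, _, rfl, rfl⟩, q, hq, he⟩ :=
      hb ⟨y, (sub2 y).2 hy, _, ⟨_, ⟨_, hw, rfl⟩, rfl⟩, rfl⟩
    have hu1 := (sub1 u).1 hu v
    have hq1 : ⟪q, v⟫ = 0 := (Submodule.mem_orthogonal' _ _).1 hq v hv
    have he2 := congrArg (fun a => ⟪a, v⟫) he
    simp only [inner_add_left, inner_sub_left, real_inner_smul_left, hq1, hyv, hWv] at he2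
    simp only [hc, inner_add_left, real_inner_smul_left]
    linarith
end

section
/- Let h1 : ℝⁿ → ℝ be convex, let T be a linear subspace of ℝⁿ with orthogonal complement Tᗮ, let x̄, w ∈ ℝⁿ and t > 0. Then h1(x̄+v) + ⟨w, v⟩ + (1/(2t))‖v‖² ≥ h1(x̄) for all v ∈ T if and only if −w ∈ ∂h1(x̄) + Tᗮ. -/
open Filter Topology RealInnerProductSpace Pointwise

/-- equivalence (5.2) ⟺ (5.3) in Proposition 5.1: `0` minimizes
`v ↦ h1(xb+v) + ⟨w,v⟩ + ‖v‖²/(2t)` over the subspace `T` iff `-w ∈ ∂h1(xb) + Tᗮ`. -/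
theorem stmt_8 {n : ℕ} (h1 : EuclideanSpace ℝ (Fin n) → ℝ)
    (hh1 : ConvexOn ℝ Set.univ h1)
    (T : Submodule ℝ (EuclideanSpace ℝ (Fin n)))
    (xb w : EuclideanSpace ℝ (Fin n)) (t : ℝ) (ht : 0 < t) :
    (∀ v ∈ T, h1 (xb + v) + ⟪w, v⟫ + 1 / (2 * t) * ‖v‖ ^ 2 ≥ h1 xb)
      ↔ -w ∈ convexSubdiff h1 xb + (Tᗮ : Set (EuclideanSpace ℝ (Fin n))) := by
  constructor
  · intro H
    have key : ∀ v ∈ T, h1 xb ≤ h1 (xb + v) + ⟪w, v⟫ := by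
      intro v hv
      by_contra hlt
      push Not at hlt
      obtain ⟨K, hK⟩ : ∃ K, K = 1 / (2 * t) * ‖v‖ ^ 2 := ⟨_, rfl⟩
      have hK0 : 0 ≤ K := by rw [hK]; positivity
      obtain ⟨D, hD⟩ : ∃ D, D = h1 (xb + v) + ⟪w, v⟫ - h1 xb := ⟨_, rfl⟩
      have hD0 : D < 0 := by linarith
      obtain ⟨s, hs⟩ : ∃ s, s = -D / (K - D) := ⟨_, rfl⟩
      have hKD : 0 < K - D := by linarith
      have hs0 : 0 < s := by rw [hs]; exact div_pos (by linarith) hKD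
      have hs1 : s ≤ 1 := by rw [hs, div_le_one hKD]; linarith
      have hsK : s * (K - D) = -D := by rw [hs]; field_simp
      have h2 := H (s • v) (T.smul_mem s hv)
      have h3 := hh1.2 (Set.mem_univ xb) (Set.mem_univ (xb + v))
        (by linarith : 0 ≤ 1 - s) hs0.le (by ring)
      have e : (1 - s) • xb + s • (xb + v) = xb + s • v := by module
      rw [e] at h3
      rw [real_inner_smul_right, norm_smul, mul_pow, Real.norm_eq_abs, sq_abs] at h2
      have h4 : 1 / (2 * t) * (s ^ 2 * ‖v‖ ^ 2) = s ^ 2 * K := by rw [hK]; ring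
      rw [h4] at h2
      simp only [smul_eq_mul] at h3
      have h5 : 0 ≤ s * (D + s * K) := by rw [hD]; nlinarith
      have h6 : 0 ≤ D + s * K := nonneg_of_mul_nonneg_right h5 hs0
      nlinarith
    have hcont : Continuous h1 := by
      rw [← continuousOn_univ]
      exact hh1.continuousOn isOpen_univ
    have hSc : Convex ℝ {p : EuclideanSpace ℝ (Fin n) × ℝ | h1 p.1 < p.2} := by
      simpa using hh1.convex_strict_epigraph
    have hSo : IsOpen {p : EuclideanSpace ℝ (Fin n) × ℝ | h1 p.1 < p.2} :=
      isOpen_lt (hcont.comp continuous_fst) continuous_snd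
    have hAc : Convex ℝ {p : EuclideanSpace ℝ (Fin n) × ℝ |
        ∃ v ∈ T, p = (xb + v, h1 xb - ⟪w, v⟫)} := by
      rintro _ ⟨v, hv, rfl⟩ _ ⟨v', hv', rfl⟩ a b _ _ hab
      refine ⟨a • v + b • v', T.add_mem (T.smul_mem a hv) (T.smul_mem b hv'), ?_⟩
      obtain rfl : a = 1 - b := by linarith
      ext1
      · simp only [Prod.fst_add, Prod.smul_fst]
        module
      · simp only [Prod.snd_add, Prod.smul_snd, inner_add_right, real_inner_smul_right,
          smul_eq_mul]
        ring
    obtain ⟨f, u, hf1, hf2⟩ := geometric_hahn_banach_open hSc hSo hAc (by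
      rw [Set.disjoint_left]
      rintro _ hp ⟨v, hv, rfl⟩
      have := key v hv
      simp only [Set.mem_setOf_eq] at hp
      linarith)
    obtain ⟨L, hL⟩ : ∃ L : StrongDual ℝ (EuclideanSpace ℝ (Fin n)),
      L = f.comp (ContinuousLinearMap.inl ℝ _ ℝ) := ⟨_, rfl⟩
    obtain ⟨c, hc⟩ : ∃ c : ℝ, c = f (0, 1) := ⟨_, rfl⟩
    have hf : ∀ x r, f (x, r) = L x + c * r := by
      intro x r
      have : ((x, r) : EuclideanSpace ℝ (Fin n) × ℝ) = (x, 0) + r • (0, 1) := by simp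
      rw [this, map_add, map_smul, hL, hc]
      simp [mul_comm]
    have hS : ∀ z r, h1 z < r → L z + c * r < u := fun z r h => by
      rw [← hf]; exact hf1 _ h
    have hA : ∀ v ∈ T, u ≤ L xb + L v + c * (h1 xb - ⟪w, v⟫) := fun v hv => by
      rw [← map_add, ← hf]; exact hf2 _ ⟨v, hv, rfl⟩
    have hA0 := hA 0 T.zero_mem
    simp only [map_zero, inner_zero_right, add_zero, sub_zero] at hA0
    have hc0 : c < 0 := by
      have := hS xb (h1 xb + 1) (by linarith)
      nlinarith
    have hz : ∀ z, L z + c * h1 z ≤ u := by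
      intro z
      by_contra hlt
      push Not at hlt
      have h2 := hS z (h1 z + (L z + c * h1 z - u) / (-c))
        (by have := div_pos (sub_pos.2 hlt) (neg_pos.2 hc0); linarith)
      have h3 : c * ((L z + c * h1 z - u) / (-c)) = -(L z + c * h1 z - u) := by
        have := hc0.ne
        field_simp
      rw [mul_add, h3] at h2
      linarith
    have hu : u = L xb + c * h1 xb := le_antisymm hA0 (hz xb)
    have hT : ∀ v ∈ T, L v = c * ⟪w, v⟫ := by
      intro v hv
      have h2 := hA v hv
      have h3 := hA (-v) (T.neg_mem hv)
      simp only [map_neg, inner_neg_right] at h3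
      nlinarith
    obtain ⟨y, hy⟩ : ∃ y : EuclideanSpace ℝ (Fin n), ∀ v, ⟪y, v⟫ = L v :=
      ⟨(InnerProductSpace.toDual ℝ _).symm L, fun v => by simp⟩
    refine Set.mem_add.2 ⟨(-c⁻¹) • y, ?_, -w - (-c⁻¹) • y, ?_, by abel⟩
    · intro z
      rw [real_inner_smul_left, hy, map_sub]
      have h2 := hz z
      rw [hu] at h2
      have h3 : 0 ≤ -c⁻¹ := by have := inv_lt_zero.2 hc0; linarith
      have h4 := mul_le_mul_of_nonneg_left h2 h3
      have h5 : ∀ a : ℝ, -c⁻¹ * (c * a) = -a := fun a => by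
        have := hc0.ne
        field_simp
      rw [mul_add, mul_add, h5, h5] at h4
      linarith
    · rw [SetLike.mem_coe, Submodule.mem_orthogonal']
      intro v hv
      rw [inner_sub_left, inner_neg_left, real_inner_smul_left, hy, hT v hv]
      have := hc0.ne
      field_simp
      ring
  · intro H v hv
    obtain ⟨y, hy, q, hq, hyq⟩ := Set.mem_add.1 H
    have h2 := hy (xb + v)
    rw [add_sub_cancel_left] at h2
    have h3 : ⟪q, v⟫ = 0 := (Submodule.mem_orthogonal' T q).1 hq v hv
    have h4 : ⟪y, v⟫ + ⟪q, v⟫ = -⟪w, v⟫ := by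
      rw [← inner_add_left, hyq, inner_neg_left]
    have h5 : 0 ≤ 1 / (2 * t) * ‖v‖ ^ 2 := by positivity
    linarith
end

section
/- Let f : ℝⁿ → ℝ be nonnegative and locally Lipschitz continuous, let g : ℝⁿ → ℝ be continuously differentiable, and let x, v ∈ ℝⁿ with g(x) > 0. Then the Clarke generalized directional derivatives satisfy (f/g)°(x;v) = f°(x;v)/g(x) − (f(x)/g(x)²)·⟨∇g(x), v⟩. -/
open Filter Topology RealInnerProductSpace

/-- The Clarke generalized directional derivative of `φ : ℝⁿ → ℝ` at `x` along `v`: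
`limsup_{y → x, t ↓ 0} (φ(y + t v) - φ(y)) / t`. -/
noncomputable def clarkeDeriv {n : ℕ} (φ : EuclideanSpace ℝ (Fin n) → ℝ)
    (x v : EuclideanSpace ℝ (Fin n)) : ℝ :=
  Filter.limsup
    (fun p : EuclideanSpace ℝ (Fin n) × ℝ => (φ (p.1 + p.2 • v) - φ p.1) / p.2)
    ((𝓝 x) ×ˢ (𝓝[>] (0 : ℝ)))

theorem aux_limsup_le {α : Type*} {l : Filter α} [l.NeBot] {u w : α → ℝ} {M N : ℝ}
    (hu : ∀ᶠ p in l, |u p| ≤ M) (hw : ∀ᶠ p in l, |w p| ≤ N)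
    (h : Tendsto (fun p => u p - w p) l (𝓝 0)) : limsup u l ≤ limsup w l := by
  refine le_of_forall_pos_le_add fun ε hε => ?_
  have hwb : IsBoundedUnder (· ≤ ·) l w :=
    ⟨N, by simpa using hw.mono fun p hp => (abs_le.1 hp).2⟩
  have hub : IsCoboundedUnder (· ≤ ·) l u := by
    apply IsBoundedUnder.isCoboundedUnder_le
    exact ⟨-M, by simpa using hu.mono fun p hp => (abs_le.1 hp).1⟩
  have h1 : ∀ᶠ p in l, w p < limsup w l + ε / 2 :=
    eventually_lt_of_limsup_lt (by linarith) hwb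
  have h2 : ∀ᶠ p in l, u p - w p < ε / 2 := h.eventually_lt_const (by linarith)
  refine limsup_le_of_le hub ?_
  filter_upwards [h1, h2] with p a b
  linarith

theorem aux_limsup_affine {α : Type*} {l : Filter α} [l.NeBot] {u w : α → ℝ} {M c d : ℝ}
    (hc : 0 < c) (hu : ∀ᶠ p in l, |u p| ≤ M)
    (h : Tendsto (fun p => w p - u p * c) l (𝓝 d)) : limsup w l = limsup u l * c + d := by
  have hmono : Monotone fun r : ℝ => r * c + d := fun a b hab => by
    simp only
    gcongr
  have hA : IsBoundedUnder (· ≤ ·) l u :=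
    ⟨M, by simpa using hu.mono fun p hp => (abs_le.1 hp).2⟩
  have hB : IsBoundedUnder (· ≥ ·) l u :=
    ⟨-M, by simpa using hu.mono fun p hp => (abs_le.1 hp).1⟩
  have h1 : limsup u l * c + d = limsup (fun p => u p * c + d) l :=
    hmono.map_limsup_of_continuousAt u (by fun_prop) hA hB.isCoboundedUnder_le
  rw [h1]
  have hd : Tendsto (fun p => w p - (u p * c + d)) l (𝓝 0) := by
    have := h.sub_const d
    simp only [sub_self] at this
    refine this.congr fun p => by ring
  have hd' : Tendsto (fun p => (u p * c + d) - w p) l (𝓝 0) := by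
    have := hd.neg
    simp only [neg_zero] at this
    refine this.congr fun p => by ring
  have hub : ∀ᶠ p in l, |u p * c + d| ≤ M * c + |d| := by
    filter_upwards [hu] with p hp
    calc _ ≤ |u p * c| + |d| := abs_add_le _ _
      _ ≤ _ := by rw [abs_mul, abs_of_pos hc]; gcongr
  have hwb : ∀ᶠ p in l, |w p| ≤ M * c + |d| + 1 := by
    have h3 : ∀ᶠ p in l, |w p - (u p * c + d)| < 1 :=
      (hd.abs).eventually_lt_const (by simp)
    filter_upwards [hub, h3] with p a b
    have := abs_add_le (w p - (u p * c + d)) (u p * c + d)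
    rw [sub_add_cancel] at this
    linarith
  exact le_antisymm (aux_limsup_le hwb hub hd) (aux_limsup_le hub hwb hd')

/-- identity in the proof of Proposition 3.9(iv):
`(f/g)°(x;v) = f°(x;v)/g(x) − (f(x)/g(x)²)⟨∇g(x), v⟩` for `f ≥ 0` locally Lipschitz and
`g` continuously differentiable with `g(x) > 0`. -/
theorem stmt_10 {n : ℕ} (f g : EuclideanSpace ℝ (Fin n) → ℝ)
    (hf0 : ∀ z, 0 ≤ f z) (hflip : LocallyLipschitz f)
    (hg : ContDiff ℝ 1 g)
    (x v : EuclideanSpace ℝ (Fin n)) (hgx : 0 < g x) :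
    clarkeDeriv (fun z => f z / g z) x v
      = clarkeDeriv f x v / g x - (f x / (g x) ^ 2) * ⟪gradient g x, v⟫ := by
  unfold clarkeDeriv
  set l := (𝓝 x) ×ˢ (𝓝[>] (0 : ℝ)) with hl
  have hy : Tendsto (fun p : EuclideanSpace ℝ (Fin n) × ℝ => p.1) l (𝓝 x) := tendsto_fst
  have ht : Tendsto (fun p : EuclideanSpace ℝ (Fin n) × ℝ => p.2) l (𝓝 0) :=
    tendsto_snd.mono_right nhdsWithin_le_nhds
  have htp : ∀ᶠ p : EuclideanSpace ℝ (Fin n) × ℝ in l, 0 < p.2 :=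
    tendsto_snd.eventually self_mem_nhdsWithin
  have hz : Tendsto (fun p : EuclideanSpace ℝ (Fin n) × ℝ => p.1 + p.2 • v) l (𝓝 x) := by
    simpa using hy.add (ht.smul_const v)
  -- the difference quotients of `f` are bounded
  obtain ⟨K, s, hs, hK⟩ := hflip x
  have hfb : ∀ᶠ p : EuclideanSpace ℝ (Fin n) × ℝ in l,
      |(f (p.1 + p.2 • v) - f p.1) / p.2| ≤ K * ‖v‖ := by
    filter_upwards [htp, hy.eventually hs, hz.eventually hs] with p h0 h1 h2
    have := hK.dist_le_mul _ h2 _ h1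
    rw [Real.dist_eq, dist_eq_norm, add_sub_cancel_left, norm_smul, Real.norm_of_nonneg h0.le]
      at this
    rw [abs_div, abs_of_pos h0, div_le_iff₀ h0]
    linarith
  -- the difference quotients of `g` converge
  have hgb : Tendsto (fun p : EuclideanSpace ℝ (Fin n) × ℝ => (g (p.1 + p.2 • v) - g p.1) / p.2)
      l (𝓝 ⟪gradient g x, v⟫) := by
    have hd : DifferentiableAt ℝ g x := hg.differentiable (by norm_num) x
    have hst := (hg.contDiffAt (x := x)).hasStrictFDerivAt (by norm_num)
    have hin : ⟪gradient g x, v⟫ = fderiv ℝ g x v := by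
      simp [gradient]
    rw [hin]
    have ho := hst.isLittleO.comp_tendsto (hz.prodMk_nhds hy)
    have ho2 : (fun p : EuclideanSpace ℝ (Fin n) × ℝ =>
        g (p.1 + p.2 • v) - g p.1 - p.2 * fderiv ℝ g x v) =o[l] fun p => p.2 := by
      refine (ho.congr_left fun p => ?_).trans_isBigO ?_
      · simp
      · refine Asymptotics.IsBigO.of_bound ‖v‖ (Eventually.of_forall fun p => ?_)
        simp [norm_smul, mul_comm]
    have h3 := (ho2.tendsto_div_nhds_zero).add_const (fderiv ℝ g x v)
    rw [zero_add] at h3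
    refine h3.congr' ?_
    filter_upwards [htp] with p h0
    field_simp
    ring
  have hgc : ContinuousAt g x := hg.continuous.continuousAt
  have hfc : ContinuousAt f x := hflip.continuous.continuousAt
  have hgy := hgc.tendsto.comp hy
  have hgz := hgc.tendsto.comp hz
  have hfy := hfc.tendsto.comp hy
  have hmain := aux_limsup_affine (l := l) (c := (g x)⁻¹)
    (d := - ((f x / (g x) ^ 2) * ⟪gradient g x, v⟫))
    (w := fun p => (f (p.1 + p.2 • v) / g (p.1 + p.2 • v) - f p.1 / g p.1) / p.2)
    (inv_pos.2 hgx) hfb ?_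
  · rw [hmain]; ring
  have e1 : Tendsto (fun p : EuclideanSpace ℝ (Fin n) × ℝ =>
      ((g (p.1 + p.2 • v))⁻¹ - (g x)⁻¹) * ((f (p.1 + p.2 • v) - f p.1) / p.2)) l (𝓝 0) := by
    have h4 : Tendsto (fun p : EuclideanSpace ℝ (Fin n) × ℝ =>
      ((g (p.1 + p.2 • v))⁻¹ - (g x)⁻¹)) l (𝓝 0) := by
      simpa using (hgz.inv₀ hgx.ne').sub_const (g x)⁻¹
    refine h4.zero_mul_isBoundedUnder_le ⟨K * ‖v‖, ?_⟩
    simpa using hfb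
  have e2 := e1.sub ((hfy.div (hgy.mul hgz) (mul_pos hgx hgx).ne').mul hgb)
  rw [zero_sub, ← pow_two] at e2
  refine e2.congr' ?_
  filter_upwards [htp, hgy.eventually_const_lt hgx, hgz.eventually_const_lt hgx] with p h0 h1 h2
  simp only [Function.comp, Pi.div_apply, Pi.mul_apply] at *
  field_simp
  ring
end

section
/- Let h1 : ℝⁿ → ℝ be Lipschitz continuous with constant L1 ≥ 0, let S ⊆ ℝⁿ be a set with 0 ∈ S, let x, w ∈ ℝⁿ with ‖w‖ ≤ M2 for some M2 ≥ 0, let t with 0 < t ≤ t̄, and let v* ∈ S satisfy h1(x+v*) + ⟨w, v*⟩ + (1/(2t))‖v*‖² ≤ h1(x+v) + ⟨w, v⟩ + (1/(2t))‖v‖² for all v ∈ S. Then ‖v*‖ ≤ 2t̄(L1 + M2). -/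
open Filter Topology RealInnerProductSpace

/-- Lemma 4.1(iii): the minimizer of the proximal-gradient-subgradient
subproblem is uniformly bounded by `2 t̄ (L1 + M2)`. -/
theorem stmt_11 {n : ℕ} (h1 : EuclideanSpace ℝ (Fin n) → ℝ) (L1 : ℝ) (hL1 : 0 ≤ L1)
    (hlip : ∀ u z : EuclideanSpace ℝ (Fin n), |h1 u - h1 z| ≤ L1 * ‖u - z‖)
    (S : Set (EuclideanSpace ℝ (Fin n))) (hS : (0 : EuclideanSpace ℝ (Fin n)) ∈ S)
    (x w : EuclideanSpace ℝ (Fin n)) (M2 : ℝ) (hM2 : 0 ≤ M2) (hw : ‖w‖ ≤ M2)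
    (t tb : ℝ) (ht : 0 < t) (htb : t ≤ tb)
    (vstar : EuclideanSpace ℝ (Fin n)) (hvS : vstar ∈ S)
    (hmin : ∀ v ∈ S,
      h1 (x + vstar) + ⟪w, vstar⟫ + 1 / (2 * t) * ‖vstar‖ ^ 2
        ≤ h1 (x + v) + ⟪w, v⟫ + 1 / (2 * t) * ‖v‖ ^ 2) :
    ‖vstar‖ ≤ 2 * tb * (L1 + M2) := by
  have h0 := hmin 0 hS
  simp only [add_zero, inner_zero_right, norm_zero] at h0
  have h2 := (abs_le.mp (hlip (x + vstar) x)).1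
  rw [add_sub_cancel_left] at h2
  have h3 := (abs_le.mp (abs_real_inner_le_norm w vstar)).1
  have hn := norm_nonneg vstar
  have h4 : ‖w‖ * ‖vstar‖ ≤ M2 * ‖vstar‖ := mul_le_mul_of_nonneg_right hw hn
  have h5 : 1 / (2 * t) * ‖vstar‖ ^ 2 ≤ (L1 + M2) * ‖vstar‖ := by linarith
  have h6 : ‖vstar‖ ^ 2 ≤ 2 * t * ((L1 + M2) * ‖vstar‖) := by
    have h7 := mul_le_mul_of_nonneg_left h5 (by positivity : 0 ≤ 2 * t)
    rwa [← mul_assoc, mul_one_div_cancel (by positivity), one_mul] at h7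
  have h8 : ‖vstar‖ ≤ 2 * t * (L1 + M2) := by
    rcases hn.eq_or_lt with h | h
    · rw [← h]; positivity
    · exact le_of_mul_le_mul_right (by linarith) h
  have h9 : 2 * t * (L1 + M2) ≤ 2 * tb * (L1 + M2) := by gcongr
  exact h8.trans h9
end

section
/- Let h1 : ℝⁿ → ℝ be convex, let S ⊆ ℝⁿ be a convex set with 0 ∈ S, let x, w ∈ ℝⁿ and t > 0, and let v* ∈ S be a minimizer over S of the function v ↦ h1(x+v) + ⟨w, v⟩ + (1/(2t))‖v‖². Then for every α with 0 < α ≤ 1, h1(x + αv*) ≤ h1(x) − α⟨w, v*⟩ − (α/t)‖v*‖². -/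
open Filter Topology RealInnerProductSpace

/-- combination of (4.9) and (4.10) in the proof of Proposition 4.2:
the damped step `α • vstar` gives sufficient decrease of `h1` along the descent direction. -/
theorem stmt_13 {n : ℕ} (h1 : EuclideanSpace ℝ (Fin n) → ℝ)
    (hh1 : ConvexOn ℝ Set.univ h1)
    (S : Set (EuclideanSpace ℝ (Fin n))) (hSconv : Convex ℝ S)
    (hS : (0 : EuclideanSpace ℝ (Fin n)) ∈ S)
    (x w : EuclideanSpace ℝ (Fin n)) (t : ℝ) (ht : 0 < t)
    (vstar : EuclideanSpace ℝ (Fin n)) (hvS : vstar ∈ S)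
    (hmin : ∀ v ∈ S,
      h1 (x + vstar) + ⟪w, vstar⟫ + 1 / (2 * t) * ‖vstar‖ ^ 2
        ≤ h1 (x + v) + ⟪w, v⟫ + 1 / (2 * t) * ‖v‖ ^ 2) :
    ∀ α : ℝ, 0 < α → α ≤ 1 →
      h1 (x + α • vstar) ≤ h1 x - α * ⟪w, vstar⟫ - α / t * ‖vstar‖ ^ 2 := by
  have hconv : ∀ s : ℝ, 0 ≤ s → s ≤ 1 →
      h1 (x + s • vstar) ≤ s * h1 (x + vstar) + (1 - s) * h1 x := by
    intro s hs0 hs1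
    have h := hh1.2 (Set.mem_univ (x + vstar)) (Set.mem_univ x) hs0
      (sub_nonneg.2 hs1) (by ring)
    have e : s • (x + vstar) + (1 - s) • x = x + s • vstar := by module
    rw [e] at h
    simpa [smul_eq_mul] using h
  have hN : 0 ≤ 1 / (2 * t) * ‖vstar‖ ^ 2 := by positivity
  have hN2 : ∀ α : ℝ, α / t * ‖vstar‖ ^ 2 = α * (2 * (1 / (2 * t) * ‖vstar‖ ^ 2)) := by
    intro α
    field_simp
  have key : ∀ e : ℝ, 0 < e → e ≤ 1 →
      h1 (x + vstar) + ⟪w, vstar⟫ + (2 - e) * (1 / (2 * t) * ‖vstar‖ ^ 2) ≤ h1 x := by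
    intro e he0 he1
    have hmem : (1 - e) • vstar ∈ S :=
      hSconv.smul_mem_of_zero_mem hS hvS ⟨by linarith, by linarith⟩
    have h := hmin _ hmem
    have h2 := hconv (1 - e) (by linarith) (by linarith)
    rw [inner_smul_right, norm_smul, mul_pow, Real.norm_eq_abs, sq_abs] at h
    refine le_of_mul_le_mul_left ?_ he0
    linarith
  have main : h1 (x + vstar) + ⟪w, vstar⟫ + 2 * (1 / (2 * t) * ‖vstar‖ ^ 2) ≤ h1 x := by
    by_contra! hc
    generalize 1 / (2 * t) * ‖vstar‖ ^ 2 = N at *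
    obtain ⟨d, hd⟩ : ∃ d, d = h1 (x + vstar) + ⟪w, vstar⟫ + 2 * N - h1 x := ⟨_, rfl⟩
    have hdpos : 0 < d := by linarith
    have hk := key (d / (N + d)) (by positivity) (by rw [div_le_one (by linarith)]; linarith)
    have h3 : d / (N + d) * N < d := by
      rw [div_mul_eq_mul_div, div_lt_iff₀ (by linarith)]
      nlinarith
    linarith
  intro α h0 hle
  have h := hconv α h0.le hle
  have h' := mul_le_mul_of_nonneg_left main h0.le
  rw [hN2]
  linarith
end

section
/- Let φ1 : ℝⁿ → ℝ be continuously differentiable at x̄ with φ1(x̄) > 0, and let φ2 : ℝⁿ → ℝ be continuous at x̄. Then the Fréchet subdifferential of the product satisfies ∂̂(φ1·φ2)(x̄) = {φ2(x̄)·∇φ1(x̄) + φ1(x̄)·u : u ∈ ∂̂φ2(x̄)}. -/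
open Filter Topology RealInnerProductSpace

theorem mem_frechetSubdiff_iff {n : ℕ} (ψ : EuclideanSpace ℝ (Fin n) → ℝ)
    (x y : EuclideanSpace ℝ (Fin n)) :
    y ∈ frechetSubdiff ψ x ↔ ∀ ε > (0 : ℝ), ∀ᶠ z in 𝓝 x,
      ψ z ≥ ψ x + ⟪y, z - x⟫ - ε * ‖z - x‖ := by
  simp only [frechetSubdiff, Set.mem_setOf_eq, Metric.eventually_nhds_iff, dist_eq_norm]

theorem product_remainder {n : ℕ} (φ1 φ2 : EuclideanSpace ℝ (Fin n) → ℝ)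
    (x : EuclideanSpace ℝ (Fin n)) (hd : DifferentiableAt ℝ φ1 x) (hc : ContinuousAt φ2 x) :
    (fun z => φ1 z * φ2 z - φ1 x * φ2 x - φ1 x * (φ2 z - φ2 x)
      - φ2 x * ⟪gradient φ1 x, z - x⟫) =o[𝓝 x] fun z => z - x := by
  have h1 : (fun z => φ1 z - φ1 x - ⟪gradient φ1 x, z - x⟫) =o[𝓝 x] fun z => z - x :=
    hasGradientAt_iff_isLittleO.mp hd.hasGradientAt
  have h2 : (fun z => φ1 z - φ1 x) =O[𝓝 x] fun z => z - x := hd.hasFDerivAt.isBigO_sub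
  have h3 : (fun z => φ2 z - φ2 x) =o[𝓝 x] fun _ => (1 : ℝ) := by
    rw [Asymptotics.isLittleO_one_iff]
    simpa using hc.tendsto.sub_const (φ2 x)
  have h4 : (fun z => (φ1 z - φ1 x) * (φ2 z - φ2 x)) =o[𝓝 x] fun z => z - x := by
    have := h2.norm_right.mul_isLittleO h3
    simp only [mul_one] at this
    exact this.of_norm_right
  refine (h4.add (h1.const_mul_left (φ2 x))).congr_left fun z => ?_
  ring

theorem product_iff {n : ℕ} (φ1 φ2 : EuclideanSpace ℝ (Fin n) → ℝ)
    (x u : EuclideanSpace ℝ (Fin n)) (hd : DifferentiableAt ℝ φ1 x) (hc : ContinuousAt φ2 x)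
    (hpos : 0 < φ1 x) :
    φ2 x • gradient φ1 x + φ1 x • u ∈ frechetSubdiff (fun z => φ1 z * φ2 z) x ↔
      u ∈ frechetSubdiff φ2 x := by
  have hR := product_remainder φ1 φ2 x hd hc
  rw [mem_frechetSubdiff_iff, mem_frechetSubdiff_iff]
  constructor
  · intro h ε hε
    have hp : 0 < φ1 x * ε / 2 := by positivity
    filter_upwards [h _ hp, hR.def hp] with z hz hz2
    rw [Real.norm_eq_abs, abs_le] at hz2
    simp only [inner_add_left, real_inner_smul_left] at hz
    refine le_of_mul_le_mul_left ?_ hpos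
    nlinarith [hz2.2]
  · intro h ε hε
    have hp : 0 < ε / (2 * φ1 x) := by positivity
    filter_upwards [h _ hp, hR.def (half_pos hε)] with z hz hz2
    rw [Real.norm_eq_abs, abs_le] at hz2
    simp only [inner_add_left, real_inner_smul_left]
    have h5 := mul_le_mul_of_nonneg_left hz hpos.le
    have h6 : φ1 x * (ε / (2 * φ1 x) * ‖z - x‖) = ε / 2 * ‖z - x‖ := by
      field_simp
    rw [mul_sub, h6] at h5
    nlinarith [hz2.1]

/-- product rule verified in the proof of Proposition 6.1: if `φ1` is
continuously differentiable at `xb` with `φ1(xb) > 0` and `φ2` is continuous at `xb`, then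
`∂̂(φ1·φ2)(xb) = φ2(xb)∇φ1(xb) + φ1(xb)·∂̂φ2(xb)`. -/
theorem stmt_15 {n : ℕ} (φ1 φ2 : EuclideanSpace ℝ (Fin n) → ℝ)
    (xb : EuclideanSpace ℝ (Fin n))
    (s : Set (EuclideanSpace ℝ (Fin n))) (hs : s ∈ 𝓝 xb)
    (hdiff : ∀ y ∈ s, DifferentiableAt ℝ φ1 y)
    (hgradcont : ContinuousAt (gradient φ1) xb)
    (hpos : 0 < φ1 xb) (hcont : ContinuousAt φ2 xb) :
    frechetSubdiff (fun z => φ1 z * φ2 z) xb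
      = {y | ∃ u ∈ frechetSubdiff φ2 xb,
          y = φ2 xb • gradient φ1 xb + φ1 xb • u} := by
  have hd := hdiff xb (mem_of_mem_nhds hs)
  ext y
  constructor
  · intro hy
    have e : y = φ2 xb • gradient φ1 xb
        + φ1 xb • ((φ1 xb)⁻¹ • (y - φ2 xb • gradient φ1 xb)) := by
      rw [smul_inv_smul₀ hpos.ne']
      abel
    refine ⟨_, ?_, e⟩
    rw [e] at hy
    exact (product_iff φ1 φ2 xb _ hd hcont hpos).mp hy
  · rintro ⟨u, hu, rfl⟩
    exact (product_iff φ1 φ2 xb u hd hcont hpos).mpr hu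
end
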